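/- (Completeness of SL*; Grabmayer–Fokkink.) For all 1-free star expressions r1, r2 ∈ StExp, if r1 and r2 are bisimilar as states of the syntactic chart (StExp, δ), then SL* ⊢ r1 = r2. -/

import Mathlib

/-- A chart over action alphabet `Act` with state space `X`: each state is assigned a
finite set of transitions, either `(a, none)` (i.e. `x →a ✓`) or `(a, some y)` (i.e. `x →a y`). -/
structure Chart (Act X : Type) where
  tr : X → Finset (Act × Option X)

/-- `x →a ✓` in the chart `C`. -/
def Chart.Halts {Act X : Type} (C : Chart Act X) (x : X) : Prop :=
  ∃ a : Act, (a, (none : Option X)) ∈ C.tr x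

/-- `x → y` (for some action) in the chart `C`. -/
def Chart.StepRel {Act X : Type} (C : Chart Act X) (x y : X) : Prop :=
  ∃ a : Act, (a, some y) ∈ C.tr x

/-- `R` is a bisimulation between the charts `C` and `D`. -/
def IsBisim {Act X Y : Type} (C : Chart Act X) (D : Chart Act Y) (R : X → Y → Prop) : Prop :=
  ∀ x y, R x y → ∀ a : Act,
    (((a, (none : Option X)) ∈ C.tr x) ↔ ((a, (none : Option Y)) ∈ D.tr y)) ∧
    (∀ x', (a, some x') ∈ C.tr x → ∃ y', (a, some y') ∈ D.tr y ∧ R x' y') ∧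
    (∀ y', (a, some y') ∈ D.tr y → ∃ x', (a, some x') ∈ C.tr x ∧ R x' y')

/-- States `x` of `C` and `y` of `D` are bisimilar. -/
def Bisimilar {Act X Y : Type} (C : Chart Act X) (D : Chart Act Y) (x : X) (y : Y) : Prop :=
  ∃ R, IsBisim C D R ∧ R x y

/-- A chart homomorphism is a function whose graph is a bisimulation. -/
def IsChartHom {Act X Y : Type} (C : Chart Act X) (D : Chart Act Y) (h : X → Y) : Prop :=
  IsBisim C D (fun x y => h x = y)

/-- 1-free star expressions over the alphabet `Act`. -/
inductive StExp (Act : Type) : Type where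
  | zero : StExp Act
  | act : Act → StExp Act
  | add : StExp Act → StExp Act → StExp Act
  | mul : StExp Act → StExp Act → StExp Act
  | star : StExp Act → StExp Act → StExp Act
deriving DecidableEq

/-- Continuation after a transition of the left operand: `✓` continues as `s`,
and a state `t` continues as `t·s`. -/
def StExp.seqAfter {Act : Type} (s : StExp Act) : Option (StExp Act) → StExp Act
  | none => s
  | some t => t.mul s

/-- The transition function of the syntactic chart, following Antimirov-style rules. -/
def StExp.tr {Act : Type} [DecidableEq Act] : StExp Act → Finset (Act × Option (StExp Act))
  | .zero => ∅
  | .act a => {(a, none)}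
  | .add r s => r.tr ∪ s.tr
  | .mul r s => r.tr.image (fun p => (p.1, some (StExp.seqAfter s p.2)))
  | .star r s =>
      (r.tr.image (fun p => (p.1, some (StExp.seqAfter (StExp.star r s) p.2)))) ∪ s.tr

/-- The syntactic chart `(StExp, δ)`. -/
def synChart (Act : Type) [DecidableEq Act] : Chart Act (StExp Act) := ⟨StExp.tr⟩

/-- Derivability `SL* ⊢ r = s` from Grabmayer and Fokkink's axioms together with
the laws of equational logic. -/
inductive SLEq {Act : Type} : StExp Act → StExp Act → Prop where
  | add_comm (x y : StExp Act) : SLEq (x.add y) (y.add x)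
  | add_assoc (x y z : StExp Act) : SLEq ((x.add y).add z) (x.add (y.add z))
  | add_idem (x : StExp Act) : SLEq (x.add x) x
  | add_zero (x : StExp Act) : SLEq (x.add .zero) x
  | right_distrib (x y z : StExp Act) : SLEq ((x.add y).mul z) ((x.mul z).add (y.mul z))
  | mul_assoc (x y z : StExp Act) : SLEq ((x.mul y).mul z) (x.mul (y.mul z))
  | zero_mul (x : StExp Act) : SLEq (StExp.zero.mul x) .zero
  | star_unfold (x y : StExp Act) : SLEq (x.star y) ((x.mul (x.star y)).add y)
  | fixpoint {x y z : StExp Act} : SLEq x ((y.mul x).add z) → SLEq x (y.star z)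
  | refl (x : StExp Act) : SLEq x x
  | symm {x y : StExp Act} : SLEq x y → SLEq y x
  | trans {x y z : StExp Act} : SLEq x y → SLEq y z → SLEq x z
  | add_congr {x x' y y' : StExp Act} : SLEq x x' → SLEq y y' → SLEq (x.add y) (x'.add y')
  | mul_congr {x x' y y' : StExp Act} : SLEq x x' → SLEq y y' → SLEq (x.mul y) (x'.mul y')
  | star_congr {x x' y y' : StExp Act} : SLEq x x' → SLEq y y' → SLEq (x.star y) (x'.star y')

section Graphs

variable {X Y : Type}

/-- Every path of `R` from the given state reaches `v` or gets stuck after finitely many steps,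
and meets no exit state in `H` before reaching `v`. -/
inductive LoopsBack (R : X → X → Prop) (H : X → Prop) (v : X) : X → Prop
  | refl : LoopsBack R H v v
  | step {y : X} : ¬ H y → (∀ z, R y z → LoopsBack R H v z) → LoopsBack R H v y

/-- The loop existence and elimination property: repeatedly removing edges `a → b` all of whose
continuations loop back to `a` leads to a graph without infinite paths. -/
inductive LoopElim (H : X → Prop) : (X → X → Prop) → Prop
  | wf {R : X → X → Prop} : WellFounded (fun a b => R b a) → LoopElim H R
  | step {R R₁ : X → X → Prop} : (∀ a b, R₁ a b → R a b) →
      (∀ a b, R a b → R₁ a b ∨ LoopsBack R H a b) → LoopElim H R₁ → LoopElim H R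

theorem LoopsBack.trans {R : X → X → Prop} {H : X → Prop} {u v y : X}
    (h : LoopsBack R H v y) (hv : LoopsBack R H u v) : LoopsBack R H u y := by
  induction h with
  | refl => exact hv
  | step hy _ ih => exact .step hy ih

theorem LoopsBack.map {R : X → X → Prop} {H : X → Prop} {S : Y → Y → Prop} {K : Y → Prop}
    (h : X → Y) (lift : ∀ x y', S (h x) y' → ∃ x', R x x' ∧ h x' = y')
    (hK : ∀ x, K (h x) → H x) {v y : X} (hb : LoopsBack R H v y) :
    LoopsBack S K (h v) (h y) := by
  induction hb with
  | refl => exact .refl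
  | step hy _ ih =>
    refine .step (fun hk => hy (hK _ hk)) fun z hz => ?_
    obtain ⟨x', hx', rfl⟩ := lift _ _ hz
    exact ih _ hx'

theorem LoopsBack.mono {R S : X → X → Prop} {H : X → Prop} (hS : ∀ a b, S a b → R a b)
    {v y : X} (hb : LoopsBack R H v y) : LoopsBack S H v y :=
  hb.map id (fun _ y' h => ⟨y', hS _ _ h, rfl⟩) fun _ h => h

/-- Loop elimination passes to functional-bisimulation images. -/
theorem LoopElim.map {R : X → X → Prop} {H : X → Prop} (hR : LoopElim H R)
    {S : Y → Y → Prop} {K : Y → Prop} (h : X → Y)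
    (lift : ∀ x y', S (h x) y' → ∃ x', R x x' ∧ h x' = y')
    (hK : ∀ x, K (h x) → H x) (range : ∀ y y', S y y' → ∃ x, h x = y) : LoopElim K S := by
  induction hR generalizing S with
  | wf hwf =>
    refine .wf ⟨?_⟩
    have key : ∀ x, Acc (fun a b => S b a) (h x) := by
      intro x
      induction x using hwf.induction with
      | _ x ih =>
        refine ⟨_, fun y' hy' => ?_⟩
        obtain ⟨x', hx', rfl⟩ := lift _ _ hy'
        exact ih _ hx'
    refine fun y => ⟨_, fun y' hy' => ?_⟩
    obtain ⟨x, rfl⟩ := range _ _ hy'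
    exact (key x).inv hy'
  | step _ hcov _ ih =>
    refine .step (R₁ := fun a b => S a b ∧ ¬ LoopsBack S K a b) (fun _ _ h => h.1)
      (fun a b hab => ?_) (ih ?_ ?_)
    · by_cases hb : LoopsBack S K a b
      · exact .inr hb
      · exact .inl ⟨hab, hb⟩
    · rintro x y' ⟨hs, hn⟩
      obtain ⟨x', hx', rfl⟩ := lift _ _ hs
      rcases hcov _ _ hx' with h1 | h1
      · exact ⟨x', h1, rfl⟩
      · exact absurd (h1.map h lift hK) hn
    · exact fun y y' hs => range y y' hs.1

theorem LoopElim.mono {R S : X → X → Prop} {H K : X → Prop} (hR : LoopElim H R)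
    (hS : ∀ a b, S a b → R a b) (hK : ∀ a, K a → H a) : LoopElim K S :=
  hR.map id (fun _ y' h => ⟨y', hS _ _ h, rfl⟩) hK fun y _ _ => ⟨y, rfl⟩

/-- The graph obtained by bypassing the state `w`. -/
def bypass (R : X → X → Prop) (w a b : X) : Prop :=
  a ≠ b ∧ a ≠ w ∧ b ≠ w ∧ (R a b ∨ R a w ∧ R w b)

theorem bypass_mono {R S : X → X → Prop} (hS : ∀ a b, S a b → R a b) (w a b : X)
    (h : bypass S w a b) : bypass R w a b :=
  ⟨h.1, h.2.1, h.2.2.1, h.2.2.2.imp (hS _ _) (And.imp (hS _ _) (hS _ _))⟩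

theorem wellFounded_bypass {R : X → X → Prop} (h : WellFounded (fun a b => R b a)) (w : X) :
    WellFounded (fun a b => bypass R w b a) := by
  refine Subrelation.wf ?_ h.transGen
  rintro a b ⟨-, -, -, hab | ⟨h1, h2⟩⟩
  · exact .single hab
  · exact .tail (.single h2) h1

/-- Bypassing a non-exit state with a single successor preserves loop elimination. -/
theorem LoopElim.bypass_of_unique {R : X → X → Prop} {H : X → Prop} (hR : LoopElim H R)
    {w x : X} (hw : ¬ H w) (hwx : x ≠ w) (huniq : ∀ z, R w z → z = x) :
    LoopElim H (bypass R w) := by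
  induction hR with
  | wf hwf => exact .wf (wellFounded_bypass hwf w)
  | @step R R₁ hle hcov _ ih =>
    specialize ih fun z hz => huniq z (hle _ _ hz)
    have key : ∀ v, v ≠ w → ∀ a, LoopsBack R H v a →
        (a ≠ w → LoopsBack (bypass R w) H v a) ∧
        (a = w → ∀ z, R w z → LoopsBack (bypass R w) H v z) := by
      intro v hv a ha
      induction ha with
      | refl => exact ⟨fun _ => .refl, fun h => absurd h hv⟩
      | step hy _ ihb =>
        refine ⟨fun _ => .step hy fun z hz => ?_, ?_⟩
        · obtain ⟨-, -, hzw, h1 | ⟨h1, h2⟩⟩ := hz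
          · exact (ihb _ h1).1 hzw
          · exact (ihb _ h1).2 rfl _ h2
        · rintro rfl z hz
          exact (ihb z hz).1 (huniq z hz ▸ hwx)
    by_cases hb : R w x ∧ LoopsBack R H w x
    · obtain ⟨-, hb⟩ := hb
      cases hb with
      | refl => exact absurd rfl hwx
      | step hx hb =>
        have hxw : LoopsBack R H x w := .step hw fun z hz => huniq z hz ▸ .refl
        have hloop : ∀ z, bypass R w x z → LoopsBack (bypass R w) H x z := by
          rintro z ⟨hne, -, hzw, h1 | ⟨-, h2⟩⟩
          · exact (key x hwx z ((hb z h1).trans hxw)).1 hzw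
          · exact absurd (huniq z h2).symm hne
        have hsub : ∀ a b, (a ≠ x ∧ bypass R w a b) → bypass R w a b := fun _ _ h => h.2
        refine .step (R₁ := fun a b => a ≠ x ∧ bypass R w a b) hsub (fun a b hab => ?_) <|
          .step (R₁ := fun a b => a ≠ x ∧ bypass R₁ w a b)
            (fun a b h => ⟨h.1, bypass_mono hle _ _ _ h.2⟩) (fun a b hab => ?_)
            (ih.mono (fun _ _ h => h.2) fun _ h => h)
        · by_cases hax : a = x
          · subst hax
            exact .inr (hloop b hab)
          · exact .inl ⟨hax, hab⟩
        · obtain ⟨hax, hne, haw, hbw, h1 | ⟨h1, h2⟩⟩ := hab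
          · rcases hcov _ _ h1 with h3 | h3
            · exact .inl ⟨hax, hne, haw, hbw, .inl h3⟩
            · exact .inr (((key a haw b h3).1 hbw).mono hsub)
          · obtain rfl := huniq b h2
            exact .inr (.step hx fun z hz => absurd rfl hz.1)
    · refine .step (bypass_mono hle w) ?_ ih
      rintro a b ⟨hne, haw, hbw, h1 | ⟨h1, h2⟩⟩
      · rcases hcov _ _ h1 with h3 | h3
        · exact .inl ⟨hne, haw, hbw, .inl h3⟩
        · exact .inr ((key a haw b h3).1 hbw)
      · obtain rfl := huniq b h2
        rcases hcov _ _ h1 with h3 | h3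
        · rcases hcov _ _ h2 with h4 | h4
          · exact .inl ⟨hne, haw, hbw, .inr ⟨h3, h4⟩⟩
          · exact absurd ⟨h2, h4⟩ hb
        · exact .inr ((key a haw w h3).2 rfl b h2)

/-- Bypassing a state without successors preserves loop elimination, provided that the
predecessors of an exit state become exit states. -/
theorem LoopElim.bypass_of_isEmpty {R : X → X → Prop} {H : X → Prop} (hR : LoopElim H R)
    {w : X} (hdead : ∀ z, ¬ R w z) :
    LoopElim (fun a => H a ∨ R a w ∧ H w) (bypass R w) := by
  induction hR with
  | wf hwf => exact .wf (wellFounded_bypass hwf w)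
  | @step R R₁ hle hcov _ ih =>
    specialize ih fun z hz => hdead z (hle _ _ hz)
    have key : ∀ v, v ≠ w → ∀ a, LoopsBack R H v a →
        LoopsBack (bypass R w) (fun a => H a ∨ R a w ∧ H w) v a ∧ (a = w → ¬ H w) := by
      intro v hv a ha
      induction ha with
      | refl => exact ⟨.refl, fun h => absurd h hv⟩
      | step hy _ ihb =>
        refine ⟨.step ?_ fun z hz => ?_, fun h => h ▸ hy⟩
        · rintro (h | ⟨h1, h2⟩)
          · exact hy h
          · exact (ihb _ h1).2 rfl h2
        · obtain ⟨-, -, -, h1 | ⟨h1, h2⟩⟩ := hz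
          · exact (ihb _ h1).1
          · exact absurd h2 (hdead _)
    refine .step (bypass_mono hle w) ?_ (ih.mono (fun _ _ h => h) ?_)
    · rintro a b ⟨hne, haw, hbw, h1 | ⟨h1, h2⟩⟩
      · rcases hcov _ _ h1 with h3 | h3
        · exact .inl ⟨hne, haw, hbw, .inl h3⟩
        · exact .inr (key a haw b h3).1
      · exact absurd h2 (hdead _)
    · rintro a (h | ⟨h1, h2⟩)
      · exact .inl h
      · rcases hcov _ _ h1 with h3 | h3
        · exact .inr ⟨h3, h2⟩
        · exact absurd h2 ((key a (fun h => hdead _ (h ▸ h1)) w h3).2 rfl)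

theorem LoopsBack.exists_unique_succ {R : X → X → Prop} {H : X → Prop} {S : Set X}
    (hS : ∀ a b, R a b → b ∈ S) {v y : X} (hb : LoopsBack R H v y) (hy : y ∈ S) (hyv : y ≠ v) :
    ∃ w ∈ S, ¬ H w ∧ ∀ z, R w z → z = v := by
  induction hb with
  | refl => exact absurd rfl hyv
  | @step y hH _ ih =>
    by_cases h : ∀ z, R y z → z = v
    · exact ⟨y, hy, hH, h⟩
    · push Not at h
      obtain ⟨z, hz, hzv⟩ := h
      exact ih z hz (hS _ _ hz) hzv

/-- A graph with loop elimination has a state that can be bypassed. -/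
theorem LoopElim.exists_bypassable {R : X → X → Prop} {H : X → Prop} (hR : LoopElim H R)
    {S : Set X} (hne : S.Nonempty) (hS : ∀ a b, R a b → b ∈ S) (hirr : ∀ a, ¬ R a a) :
    ∃ w ∈ S, (∀ z, ¬ R w z) ∨ ¬ H w ∧ ∃ x, R w x ∧ ∀ z, R w z → z = x := by
  induction hR with
  | wf hwf =>
    obtain ⟨w, hw, hmin⟩ := hwf.has_min S hne
    exact ⟨w, hw, .inl fun z hz => hmin z (hS _ _ hz) hz⟩
  | @step R R₁ hle hcov _ ih =>
    by_cases h : ∃ a b, R a b ∧ LoopsBack R H a b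
    · obtain ⟨a, b, hab, hb⟩ := h
      obtain ⟨w, hw, hH, huniq⟩ := hb.exists_unique_succ hS (hS _ _ hab)
        (fun h => hirr a (by rwa [h] at hab))
      by_cases hwa : R w a
      · exact ⟨w, hw, .inr ⟨hH, a, hwa, huniq⟩⟩
      · exact ⟨w, hw, .inl fun z hz => hwa (huniq z hz ▸ hz)⟩
    · push Not at h
      obtain rfl : R = R₁ := by
        funext a b
        exact propext ⟨fun hab => (hcov a b hab).resolve_right (h a b hab), hle a b⟩
      exact ih hS hirr

/-- The disjoint union of two graphs with additional edges from the first to the second. -/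
def stack (R₁ : X → X → Prop) (J : X → Y → Prop) (R₂ : Y → Y → Prop) : X ⊕ Y → X ⊕ Y → Prop
  | .inl a, .inl b => R₁ a b
  | .inl a, .inr b => J a b
  | .inr _, .inl _ => False
  | .inr a, .inr b => R₂ a b

theorem LoopElim.stack {R₁ : X → X → Prop} {J : X → Y → Prop} {R₂ : Y → Y → Prop}
    {H₁ : X → Prop} {H₂ : Y → Prop} {K : X ⊕ Y → Prop}
    (h₁ : LoopElim H₁ R₁) (h₂ : LoopElim H₂ R₂) (hJ : ∀ a b, J a b → H₁ a)
    (hK₁ : ∀ a, K (.inl a) → H₁ a) (hK₂ : ∀ b, K (.inr b) → H₂ b) :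
    LoopElim K (_root_.stack R₁ J R₂) := by
  induction h₂ with
  | @wf R₂ hwf₂ =>
    induction h₁ with
    | @wf R₁ hwf₁ =>
      have hr : ∀ b, Acc (fun p q => _root_.stack R₁ J R₂ q p) (.inr b) := by
        intro b
        induction b using hwf₂.induction with
        | _ b ih =>
          refine ⟨_, ?_⟩
          rintro (a | c) h
          · exact h.elim
          · exact ih c h
      have hl : ∀ a, Acc (fun p q => _root_.stack R₁ J R₂ q p) (.inl a) := by
        intro a
        induction a using hwf₁.induction with
        | _ a ih =>
          refine ⟨_, ?_⟩
          rintro (c | b) h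
          · exact ih c h
          · exact hr b
      exact .wf ⟨fun p => p.casesOn hl hr⟩
    | @step R R' hle hcov _ ih =>
      have key : ∀ v y, LoopsBack R H₁ v y →
          LoopsBack (_root_.stack R J R₂) K (.inl v) (.inl y) := by
        intro v y hb
        induction hb with
        | refl => exact .refl
        | step hy _ ihb =>
          refine .step (fun h => hy (hK₁ _ h)) ?_
          rintro (z | z) hz
          · exact ihb z hz
          · exact absurd (hJ _ _ hz) hy
      refine .step ?_ ?_ ih
      · rintro (a | a) (b | b) h
        exacts [hle _ _ h, h, h, h]
      · rintro (a | a) (b | b) h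
        exacts [(hcov _ _ h).imp id (key _ _), .inl h, .inl h, .inl h]
  | @step R R' hle hcov _ ih =>
    have key : ∀ v y, LoopsBack R H₂ v y →
        LoopsBack (_root_.stack R₁ J R) K (.inr v) (.inr y) := by
      intro v y hb
      induction hb with
      | refl => exact .refl
      | step hy _ ihb =>
        refine .step (fun h => hy (hK₂ _ h)) ?_
        rintro (z | z) hz
        · exact hz.elim
        · exact ihb z hz
    refine .step ?_ ?_ ih
    · rintro (a | a) (b | b) h
      exacts [h, h, h, hle _ _ h]
    · rintro (a | a) (b | b) h
      exacts [.inl h, .inl h, .inl h, (hcov _ _ h).imp id (key _ _)]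

theorem LoopElim.of_isEmpty {R : X → X → Prop} {H : X → Prop} (h : ∀ a b, ¬ R a b) :
    LoopElim H R :=
  .wf ⟨fun _ => ⟨_, fun _ hb => absurd hb (h _ _)⟩⟩

/-- The graph of an iteration: the body `X` returns from its exit states to a root state, from
which the body is entered, or the continuation `Y` is started. -/
def iterGraph (R₁ : X → X → Prop) (H₁ : X → Prop) (enter : X → Prop) (start : Y → Prop)
    (R₂ : Y → Y → Prop) (p q : X ⊕ (Unit ⊕ Y)) : Prop :=
  stack R₁ (fun a b => H₁ a ∧ b = .inl ()) (stack (fun _ _ => False) (fun _ b => start b) R₂) p q ∨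
    p = .inr (.inl ()) ∧ (q = p ∨ ∃ a, enter a ∧ q = .inl a)

theorem LoopElim.iterGraph {R₁ : X → X → Prop} {H₁ enter : X → Prop} {start : Y → Prop}
    {R₂ : Y → Y → Prop} {H₂ : Y → Prop} {K : X ⊕ (Unit ⊕ Y) → Prop}
    (h₁ : LoopElim H₁ R₁) (h₂ : LoopElim H₂ R₂)
    (hK₁ : ∀ a, ¬ K (.inl a)) (hK₂ : ∀ b, K (.inr (.inr b)) → H₂ b) :
    LoopElim K (_root_.iterGraph R₁ H₁ enter start R₂) := by
  obtain ⟨E, hE⟩ : ∃ E, E = H₁ := ⟨_, rfl⟩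
  rw [← hE]
  replace hE : ∀ a, E a → H₁ a := fun a h => hE ▸ h
  induction h₁ with
  | @wf R₁ hwf =>
    have key : ∀ a, LoopsBack (_root_.iterGraph R₁ E enter start R₂) K (.inr (.inl ()))
        (.inl a) := by
      intro a
      induction a using hwf.induction with
      | _ a ih =>
        refine .step (hK₁ a) ?_
        rintro (b | b) (h | ⟨h, -⟩)
        · exact ih b h
        · cases h
        · obtain ⟨-, rfl⟩ := h
          exact .refl
        · cases h
    refine .step (fun _ _ => .inl) ?_ (LoopElim.stack (H₁ := fun _ => True)
      (H₂ := fun p => p.elim (fun _ => True) H₂) (.wf hwf) (LoopElim.stack (H₁ := fun _ => True)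
        (.of_isEmpty fun _ _ h => h) h₂ (fun _ _ _ => trivial) (fun _ _ => trivial)
        fun _ h => h) (fun _ _ _ => trivial) (fun _ _ => trivial) ?_)
    · rintro p q (h | ⟨rfl, rfl | ⟨a, -, rfl⟩⟩)
      exacts [.inl h, .inr .refl, .inr (key a)]
    · rintro (⟨⟩ | b) h
      exacts [trivial, hK₂ b h]
  | @step R R' hle hcov _ ih =>
    have key : ∀ v y, LoopsBack R H₁ v y →
        LoopsBack (_root_.iterGraph R E enter start R₂) K (.inl v) (.inl y) := by
      intro v y hb
      induction hb with
      | refl => exact .refl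
      | step hy _ ihb =>
        refine .step (hK₁ _) ?_
        rintro (z | z) (hz | ⟨hz, -⟩)
        · exact ihb z hz
        · cases hz
        · exact absurd (hE _ hz.1) hy
        · cases hz
    refine .step ?_ ?_ ih
    · rintro (a | a) (b | b) (h | h)
      exacts [.inl (hle _ _ h), .inr h, .inl h, .inr h, .inl h, .inr h, .inl h, .inr h]
    · rintro (a | a) (b | b) (h | h)
      exacts [(hcov _ _ h).imp .inl (key _ _), .inl (.inr h), .inl (.inl h), .inl (.inr h),
        .inl (.inl h), .inl (.inr h), .inl (.inl h), .inl (.inr h)]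

end Graphs

section Algebra

/-- Provable equality as a setoid. -/
def slSetoid (Act : Type) : Setoid (StExp Act) := ⟨SLEq, .refl, .symm, .trans⟩

/-- Star expressions modulo provable equality. -/
def SLAlg (Act : Type) : Type := Quotient (slSetoid Act)

variable {Act : Type}

namespace SLAlg

/-- The class of an expression. -/
def mk (r : StExp Act) : SLAlg Act := Quotient.mk (slSetoid Act) r

theorem mk_eq {r s : StExp Act} : mk r = mk s ↔ SLEq r s := Quotient.eq (r := slSetoid Act)

theorem ind {p : SLAlg Act → Prop} (h : ∀ r, p (mk r)) (a : SLAlg Act) : p a := Quotient.ind h a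

instance : Mul (SLAlg Act) := ⟨Quotient.map₂ StExp.mul fun _ _ h _ _ h' => .mul_congr h h'⟩
instance : Bot (SLAlg Act) := ⟨mk .zero⟩

/-- The binary star operation on classes. -/
def star : SLAlg Act → SLAlg Act → SLAlg Act :=
  Quotient.map₂ StExp.star fun _ _ h _ _ h' => .star_congr h h'

instance : SemilatticeSup (SLAlg Act) :=
  @SemilatticeSup.mk' _ ⟨Quotient.map₂ StExp.add fun _ _ h _ _ h' => .add_congr h h'⟩
    (ind fun r => ind fun s => mk_eq.2 (.add_comm r s))
    (ind fun r => ind fun s => ind fun t => mk_eq.2 (.add_assoc r s t))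
    (ind fun r => mk_eq.2 (.add_idem r))

theorem mk_add (r s : StExp Act) : mk (r.add s) = mk r ⊔ mk s := rfl
theorem mk_mul (r s : StExp Act) : mk (r.mul s) = mk r * mk s := rfl
theorem mk_star (r s : StExp Act) : mk (r.star s) = star (mk r) (mk s) := rfl

instance : OrderBot (SLAlg Act) where
  bot_le := ind fun r => sup_eq_right.1 <| by
    rw [sup_comm]
    exact mk_eq.2 (.add_zero r)

protected theorem sup_mul : ∀ a b c : SLAlg Act, (a ⊔ b) * c = a * c ⊔ b * c :=
  ind fun r => ind fun s => ind fun t => mk_eq.2 (.right_distrib r s t)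

protected theorem mul_assoc : ∀ a b c : SLAlg Act, a * b * c = a * (b * c) :=
  ind fun r => ind fun s => ind fun t => mk_eq.2 (.mul_assoc r s t)

theorem bot_mul : ∀ a : SLAlg Act, ⊥ * a = ⊥ :=
  ind fun r => mk_eq.2 (.zero_mul r)

theorem star_unfold : ∀ a b : SLAlg Act, star a b = a * star a b ⊔ b :=
  ind fun r => ind fun s => mk_eq.2 (.star_unfold r s)

theorem eq_star : ∀ {u a b : SLAlg Act}, u = a * u ⊔ b → u = star a b :=
  fun {u a b} => ind (p := fun u => u = a * u ⊔ b → u = star a b)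
    (fun r => ind (p := fun a => mk r = a * mk r ⊔ b → mk r = star a b)
      (fun s => ind (p := fun b => mk r = mk s * mk r ⊔ b → mk r = star (mk s) b)
        (fun _ h => mk_eq.2 (.fixpoint (mk_eq.1 h))) b) a) u

theorem eq_star_iff {u a b : SLAlg Act} : u = a * u ⊔ b ↔ u = star a b :=
  ⟨eq_star, fun h => h ▸ star_unfold a b⟩

theorem star_mul (a b c : SLAlg Act) : star a b * c = star a (b * c) :=
  eq_star <| by rw [← SLAlg.mul_assoc, ← SLAlg.sup_mul, ← star_unfold]

theorem finset_sup_mul {ι : Type} (S : Finset ι) (f : ι → SLAlg Act) (c : SLAlg Act) :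
    S.sup f * c = S.sup fun i => f i * c :=
  Finset.apply_sup_eq_sup_comp (fun a => a * c) (fun a b => SLAlg.sup_mul a b c) (bot_mul c)

end SLAlg

end Algebra

section Systems

variable {Act X : Type}

open SLAlg

/-- `s` solves the linear system with coefficients `M` and constants `q` on the unknowns `S`. -/
def IsLinSol (S : Finset X) (M : X → X → SLAlg Act) (q s : X → SLAlg Act) : Prop :=
  ∀ x ∈ S, s x = (S.sup fun y => M x y * s y) ⊔ q x

/-- The system with coefficients `M` and constants `q` has exactly one solution on `S`. -/
def UniquelySolvable (S : Finset X) (M : X → X → SLAlg Act) (q : X → SLAlg Act) : Prop :=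
  (∃ s, IsLinSol S M q s) ∧
    ∀ s s', IsLinSol S M q s → IsLinSol S M q s' → ∀ x ∈ S, s x = s' x

theorem IsLinSol.congr {S : Finset X} {M : X → X → SLAlg Act} {q s s' : X → SLAlg Act}
    (h : IsLinSol S M q s) (hs : ∀ x ∈ S, s' x = s x) : IsLinSol S M q s' := by
  intro x hx
  rw [hs x hx, h x hx]
  congr 1
  exact Finset.sup_congr rfl fun y hy => by rw [hs y hy]

/-- Gaussian elimination of the unknown `w`. -/
theorem UniquelySolvable.of_erase [DecidableEq X] {S : Finset X} {w : X}
    {M M' : X → X → SLAlg Act} {q q' : X → SLAlg Act} (F : (X → SLAlg Act) → SLAlg Act)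
    (hF : ∀ s s', (∀ x ∈ S.erase w, s x = s' x) → F s = F s')
    (hsol : ∀ s, IsLinSol S M q s ↔ IsLinSol (S.erase w) M' q' s ∧ s w = F s)
    (h : UniquelySolvable (S.erase w) M' q') : UniquelySolvable S M q := by
  obtain ⟨⟨s, hs⟩, huniq⟩ := h
  refine ⟨⟨Function.update s w (F s), (hsol _).2 ⟨hs.congr fun x hx => ?_, ?_⟩⟩, ?_⟩
  · exact Function.update_of_ne (Finset.ne_of_mem_erase hx) _ _
  · rw [Function.update_self]
    exact hF _ _ fun x hx => (Function.update_of_ne (Finset.ne_of_mem_erase hx) _ _).symm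
  · intro s s' h h' x hx
    obtain ⟨h1, h2⟩ := (hsol s).1 h
    obtain ⟨h1', h2'⟩ := (hsol s').1 h'
    have heq := huniq s s' h1 h1'
    by_cases hxw : x = w
    · rw [hxw, h2, h2', hF s s' heq]
    · exact heq x (Finset.mem_erase.2 ⟨hxw, hx⟩)

theorem sup_eq_sup_erase [DecidableEq X] {S : Finset X} {w : X} (hw : w ∈ S)
    (f : X → SLAlg Act) : S.sup f = f w ⊔ (S.erase w).sup f := by
  conv_lhs => rw [← Finset.insert_erase hw]
  rw [Finset.sup_insert]

theorem UniquelySolvable.of_unique_succ [DecidableEq X] {S : Finset X} {w x : X} (hw : w ∈ S)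
    (hx : x ∈ S) (hxw : x ≠ w) {M : X → X → SLAlg Act} {q : X → SLAlg Act}
    (hM : ∀ y ∈ S, y ≠ w → y ≠ x → M w y = ⊥) (hq : ∀ z, q w * z = q w)
    (h : UniquelySolvable (S.erase w)
      (fun y z => M y z ⊔ if z = x then M y w * star (M w w) (M w x ⊔ q w) else ⊥) q) :
    UniquelySolvable S M q := by
  have hx' : x ∈ S.erase w := Finset.mem_erase.2 ⟨hxw, hx⟩
  refine .of_erase (fun s => star (M w w) (M w x ⊔ q w) * s x)
    (fun s s' hs => by rw [hs x hx']) (fun s => ?_) h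
  set f := star (M w w) (M w x ⊔ q w) with hf
  have hwrow : s w = (S.sup fun y => M w y * s y) ⊔ q w ↔ s w = f * s x := by
    have hsup : (S.sup fun y => M w y * s y) = M w w * s w ⊔ M w x * s x := by
      rw [sup_eq_sup_erase hw, sup_eq_sup_erase hx']
      congr 1
      rw [sup_eq_left]
      refine Finset.sup_le fun y hy => ?_
      simp only [Finset.mem_erase] at hy
      rw [hM y hy.2.2 hy.2.1 hy.1, bot_mul]
      exact bot_le
    rw [hsup, sup_assoc, hf, star_mul, SLAlg.sup_mul, hq, eq_star_iff]
  have hrow : s w = f * s x → ∀ y, (S.sup fun z => M y z * s z) = (S.erase w).sup fun z =>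
      (M y z ⊔ if z = x then M y w * f else ⊥) * s z := by
    intro hs y
    have hsplit : ∀ z, (M y z ⊔ if z = x then M y w * f else ⊥) * s z =
        M y z * s z ⊔ if z = x then M y w * s w else ⊥ := by
      intro z
      rw [SLAlg.sup_mul]
      split_ifs with hz
      · rw [hz, SLAlg.mul_assoc, hs]
      · rw [bot_mul]
    simp only [hsplit]
    rw [sup_eq_sup_erase hw, sup_comm, ← Pi.sup_def, Finset.sup_sup]
    congr 1
    refine le_antisymm ?_ (Finset.sup_le fun z _ => ?_)
    · exact (if_pos rfl).ge.trans (Finset.le_sup (f := fun z => if z = x then M y w * s w else ⊥) hx')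
    · split_ifs
      exacts [le_rfl, bot_le]
  constructor
  · intro hs
    have h1 := hwrow.1 (hs w hw)
    exact ⟨fun y hy => by rw [← hrow h1 y, ← hs y (Finset.mem_of_mem_erase hy)], h1⟩
  · rintro ⟨hs, h1⟩ y hy
    by_cases hyw : y = w
    · rw [hyw]
      exact hwrow.2 h1
    · rw [hrow h1 y, ← hs y (Finset.mem_erase.2 ⟨hyw, hy⟩)]

theorem UniquelySolvable.of_no_succ [DecidableEq X] {S : Finset X} {w : X} (hw : w ∈ S)
    {M : X → X → SLAlg Act} {q : X → SLAlg Act} (hM : ∀ y ∈ S, y ≠ w → M w y = ⊥)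
    (h : UniquelySolvable (S.erase w) M fun y => q y ⊔ M y w * star (M w w) (q w)) :
    UniquelySolvable S M q := by
  refine .of_erase (fun _ => star (M w w) (q w)) (fun _ _ _ => rfl) (fun s => ?_) h
  have hwrow : s w = (S.sup fun y => M w y * s y) ⊔ q w ↔ s w = star (M w w) (q w) := by
    have hsup : (S.sup fun y => M w y * s y) = M w w * s w := by
      rw [sup_eq_sup_erase hw, sup_eq_left]
      refine Finset.sup_le fun y hy => ?_
      rw [hM y (Finset.mem_of_mem_erase hy) (Finset.ne_of_mem_erase hy), bot_mul]
      exact bot_le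
    rw [hsup, eq_star_iff]
  have hrow : s w = star (M w w) (q w) → ∀ y, (S.sup fun z => M y z * s z) ⊔ q y =
      ((S.erase w).sup fun z => M y z * s z) ⊔ (q y ⊔ M y w * star (M w w) (q w)) := by
    intro hs y
    rw [sup_eq_sup_erase hw, ← hs]
    ac_rfl
  constructor
  · intro hs
    have h1 := hwrow.1 (hs w hw)
    exact ⟨fun y hy => by rw [← hrow h1 y, ← hs y (Finset.mem_of_mem_erase hy)], h1⟩
  · rintro ⟨hs, h1⟩ y hy
    by_cases hyw : y = w
    · rw [hyw]
      exact hwrow.2 h1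
    · rw [hrow h1 y, ← hs y (Finset.mem_erase.2 ⟨hyw, hy⟩)]

/-- Linear systems whose dependency graph has loop elimination are uniquely solvable. -/
theorem LoopElim.uniquelySolvable [DecidableEq X] {S : Finset X} {M : X → X → SLAlg Act}
    {q : X → SLAlg Act} {R : X → X → Prop} {H : X → Prop} (hR : LoopElim H R)
    (hM : ∀ x ∈ S, ∀ y ∈ S, x ≠ y → M x y ≠ ⊥ → R x y)
    (hq : ∀ x ∈ S, ¬ H x → ∀ z, q x * z = q x)
    (hRS : ∀ a b, R a b → a ∈ S ∧ b ∈ S) (hirr : ∀ a, ¬ R a a) : UniquelySolvable S M q := by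
  induction hn : S.card generalizing S M q R H with
  | zero =>
    obtain rfl := Finset.card_eq_zero.1 hn
    exact ⟨⟨fun _ => ⊥, fun x hx => absurd hx (Finset.notMem_empty x)⟩,
      fun _ _ _ _ x hx => absurd hx (Finset.notMem_empty x)⟩
  | succ n ih =>
    have hne : (S : Set X).Nonempty :=
      Finset.coe_nonempty.2 (Finset.card_pos.1 (by rw [hn]; exact n.succ_pos))
    have hbypassS : ∀ w a b, bypass R w a b → a ∈ S.erase w ∧ b ∈ S.erase w := by
      rintro w a b ⟨-, haw, hbw, h | ⟨h1, h2⟩⟩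
      · exact ⟨Finset.mem_erase.2 ⟨haw, (hRS _ _ h).1⟩, Finset.mem_erase.2 ⟨hbw, (hRS _ _ h).2⟩⟩
      · exact ⟨Finset.mem_erase.2 ⟨haw, (hRS _ _ h1).1⟩,
          Finset.mem_erase.2 ⟨hbw, (hRS _ _ h2).2⟩⟩
    obtain ⟨w, hw, hdead | ⟨hH, x, hwx, huniq⟩⟩ :=
      hR.exists_bypassable hne (fun a b h => (hRS a b h).2) hirr
    · have hcard : (S.erase w).card = n := by rw [Finset.card_erase_of_mem hw, hn]; rfl
      refine .of_no_succ hw (fun y hy hyw => ?_) (ih (hR.bypass_of_isEmpty hdead) ?_ ?_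
        (hbypassS w) (fun a h => h.1 rfl) hcard)
      · by_contra hne
        exact hdead y (hM w hw y hy (Ne.symm hyw) hne)
      · intro y hy z hz hyz hne
        simp only [Finset.mem_erase] at hy hz
        exact ⟨hyz, hy.1, hz.1, .inl (hM y hy.2 z hz.2 hyz hne)⟩
      · intro y hy hyH z
        simp only [Finset.mem_erase] at hy
        rw [SLAlg.sup_mul, hq y hy.2 (fun h => hyH (.inl h))]
        by_cases hyw : M y w = ⊥
        · rw [hyw, bot_mul, bot_mul]
        · have hHw : ¬ H w := fun h => hyH (.inr ⟨hM y hy.2 w hw hy.1 hyw, h⟩)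
          rw [SLAlg.mul_assoc, star_mul, hq w hw hHw]
    · have hcard : (S.erase w).card = n := by rw [Finset.card_erase_of_mem hw, hn]; rfl
      have hxw : x ≠ w := fun h => hirr w (h ▸ hwx)
      refine .of_unique_succ hw (hRS _ _ hwx).2 hxw (fun y hy hyw hyx => ?_) (hq w hw hH)
        (ih (hR.bypass_of_unique hH hxw huniq) ?_
        (fun y hy => hq y (Finset.mem_of_mem_erase hy)) (hbypassS w) (fun a h => h.1 rfl) hcard)
      · by_contra hne
        exact hyx (huniq y (hM w hw y hy (Ne.symm hyw) hne))
      · intro y hy z hz hyz hne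
        simp only [Finset.mem_erase] at hy hz
        refine ⟨hyz, hy.1, hz.1, ?_⟩
        by_cases hyz0 : M y z = ⊥
        · right
          rw [hyz0, bot_sup_eq] at hne
          split_ifs at hne with hzx
          · refine ⟨hM y hy.2 w hw hy.1 fun h0 => hne ?_, hzx ▸ hwx⟩
            rw [h0, bot_mul]
          · exact absurd rfl hne
        · exact .inl (hM y hy.2 z hz.2 hyz hyz0)

/-- The contribution of a transition to the value of its source. -/
def transVal (s : X → SLAlg Act) : Act × Option X → SLAlg Act
  | (a, none) => mk (.act a)
  | (a, some y) => mk (.act a) * s y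

/-- `s` solves the equations read off from the chart `C` at the states in `S`. -/
def IsChartSol (C : Chart Act X) (S : Finset X) (s : X → SLAlg Act) : Prop :=
  ∀ x ∈ S, s x = (C.tr x).sup (transVal s)

/-- Finite charts with loop elimination have exactly one solution. -/
theorem LoopElim.uniqueChartSol [DecidableEq X] {C : Chart Act X} {S : Finset X}
    (hclosed : ∀ x ∈ S, ∀ y, C.StepRel x y → y ∈ S)
    (hC : LoopElim C.Halts fun a b => a ∈ S ∧ a ≠ b ∧ C.StepRel a b) :
    (∃ s, IsChartSol C S s) ∧
      ∀ s s', IsChartSol C S s → IsChartSol C S s' → ∀ x ∈ S, s x = s' x := by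
  set M : X → X → SLAlg Act := fun x y =>
    (C.tr x).sup fun p => if p.2 = some y then mk (.act p.1) else ⊥ with hM
  set q : X → SLAlg Act := fun x =>
    (C.tr x).sup fun p => if p.2 = none then mk (.act p.1) else ⊥ with hq
  have hiff : ∀ s, IsLinSol S M q s ↔ IsChartSol C S s := by
    intro s
    refine forall₂_congr fun x hx => ?_
    have hrow : (S.sup fun y => M x y * s y) ⊔ q x = (C.tr x).sup (transVal s) := by
      simp only [hM, hq, finset_sup_mul]
      rw [Finset.sup_comm, ← Finset.sup_sup]
      refine Finset.sup_congr rfl ?_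
      rintro ⟨a, _ | y⟩ hp
      · simp [transVal, bot_mul]
      · have hy : y ∈ S := hclosed x hx y ⟨a, hp⟩
        simp only [Pi.sup_apply, transVal, reduceCtorEq, if_false, sup_bot_eq, Option.some.injEq]
        refine le_antisymm (Finset.sup_le fun z _ => ?_) ?_
        · split_ifs with h
          · rw [h]
          · rw [bot_mul]
            exact bot_le
        · refine le_trans (le_of_eq ?_) (Finset.le_sup (f := fun z =>
            (if y = z then mk (.act a) else ⊥) * s z) hy)
          rw [if_pos rfl]
    rw [hrow]
  have hsolv : UniquelySolvable S M q := by
    refine hC.uniquelySolvable ?_ ?_ (fun a b h => ⟨h.1, hclosed a h.1 b h.2.2⟩)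
      (fun a h => h.2.1 rfl)
    · intro x hx y _ hxy hne
      refine ⟨hx, hxy, ?_⟩
      by_contra hstep
      refine hne (bot_unique (Finset.sup_le fun p hp => ?_))
      rw [if_neg]
      rintro h
      exact hstep ⟨p.1, by rw [← h]; exact hp⟩
    · intro x _ hH z
      have h0 : q x = ⊥ := by
        refine bot_unique (Finset.sup_le fun p hp => ?_)
        rw [if_neg]
        rintro h
        exact hH ⟨p.1, by rw [← h]; exact hp⟩
      rw [h0, bot_mul]
  simpa only [UniquelySolvable, hiff] using hsolv

end Systems

section Syntactic

variable {Act : Type} [DecidableEq Act]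

open SLAlg

/-- Every expression is provably equal to the sum over its transitions. -/
theorem mk_eq_sup_tr (r : StExp Act) : mk r = r.tr.sup (transVal mk) := by
  have hseq : ∀ (T : Finset (Act × Option (StExp Act))) (t : StExp Act),
      (T.image fun p => (p.1, some (StExp.seqAfter t p.2))).sup (transVal mk) =
        T.sup (transVal mk) * mk t := by
    intro T t
    rw [Finset.sup_image, finset_sup_mul]
    refine Finset.sup_congr rfl ?_
    rintro ⟨a, _ | y⟩ _
    · rfl
    · simp only [Function.comp, StExp.seqAfter, transVal, mk_mul, SLAlg.mul_assoc]
  induction r with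
  | zero => rfl
  | act a => simp [StExp.tr, transVal]
  | add r s ihr ihs => rw [StExp.tr, Finset.sup_union, ← ihr, ← ihs, mk_add]
  | mul r s ihr _ => rw [StExp.tr, hseq, ← ihr, mk_mul]
  | star r s ihr ihs =>
    rw [StExp.tr, Finset.sup_union, hseq, ← ihr, ← ihs, mk_star, ← star_unfold]

/-- `r` is covered by a finite graph with loop elimination. -/
def Covered (r : StExp Act) : Prop :=
  ∃ (X : Type) (_ : Fintype X) (R : X → X → Prop) (H : X → Prop) (h : X → StExp Act) (x₀ : X),
    LoopElim H R ∧ (∀ x t, (synChart Act).StepRel (h x) t → ∃ x', R x x' ∧ h x' = t) ∧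
    (∀ x, (synChart Act).Halts (h x) → H x) ∧ h x₀ = r

theorem stepRel_add {r s t : StExp Act} : (synChart Act).StepRel (r.add s) t ↔
    (synChart Act).StepRel r t ∨ (synChart Act).StepRel s t := by
  simp [Chart.StepRel, synChart, StExp.tr, exists_or]

theorem stepRel_mul {r s t : StExp Act} (h : (synChart Act).StepRel (r.mul s) t) :
    ((synChart Act).Halts r ∧ t = s) ∨ ∃ r', (synChart Act).StepRel r r' ∧ t = r'.mul s := by
  simp only [Chart.StepRel, synChart, StExp.tr, Finset.mem_image, Prod.mk.injEq] at h
  obtain ⟨a, ⟨b, _ | r'⟩, hp, -, ht⟩ := h <;> cases ht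
  · exact .inl ⟨⟨b, hp⟩, rfl⟩
  · exact .inr ⟨r', ⟨b, hp⟩, rfl⟩

theorem not_halts_mul {r s : StExp Act} : ¬ (synChart Act).Halts (r.mul s) := by
  simp [Chart.Halts, synChart, StExp.tr]

theorem stepRel_star {r s t : StExp Act} (h : (synChart Act).StepRel (r.star s) t) :
    (synChart Act).StepRel (r.mul (r.star s)) t ∨ (synChart Act).StepRel s t := by
  obtain ⟨a, h⟩ := h
  exact (Finset.mem_union.1 h).imp (fun h => ⟨a, h⟩) fun h => ⟨a, h⟩

theorem halts_star {r s : StExp Act} (h : (synChart Act).Halts (r.star s)) :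
    (synChart Act).Halts s := by
  obtain ⟨a, h⟩ := h
  rcases Finset.mem_union.1 h with h | h
  · exact absurd ⟨a, h⟩ (not_halts_mul (r := r) (s := r.star s))
  · exact ⟨a, h⟩

theorem covered (r : StExp Act) : Covered r := by
  induction r with
  | zero =>
    refine ⟨Unit, inferInstance, fun _ _ => False, fun _ => False, fun _ => .zero, (),
      .of_isEmpty fun _ _ h => h, ?_, ?_, rfl⟩ <;>
    simp [Chart.StepRel, Chart.Halts, synChart, StExp.tr]
  | act a =>
    refine ⟨Unit, inferInstance, fun _ _ => False, fun _ => True, fun _ => .act a, (),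
      .of_isEmpty fun _ _ h => h, ?_, fun _ _ => trivial, rfl⟩
    simp [Chart.StepRel, synChart, StExp.tr]
  | add r s ihr ihs =>
    obtain ⟨X, _, R₁, H₁, h₁, x₁, hR₁, hs₁, hh₁, rfl⟩ := ihr
    obtain ⟨Y, _, R₂, H₂, h₂, x₂, hR₂, hs₂, hh₂, rfl⟩ := ihs
    refine ⟨Unit ⊕ (X ⊕ Y), inferInstance, stack (fun _ _ => False)
      (fun _ b => b.elim (R₁ x₁) (R₂ x₂)) (stack R₁ (fun _ _ => False) R₂),
      Sum.elim (fun _ => True) (Sum.elim H₁ H₂),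
      Sum.elim (fun _ => (h₁ x₁).add (h₂ x₂)) (Sum.elim h₁ h₂), .inl (), ?_, ?_, ?_, rfl⟩
    · exact .stack (H₁ := fun _ => True) (H₂ := Sum.elim H₁ H₂) (.of_isEmpty fun _ _ h => h)
        (.stack hR₁ hR₂ (fun _ _ h => h.elim) (fun _ h => h) fun _ h => h)
        (fun _ _ _ => trivial) (fun _ _ => trivial) fun _ h => h
    · rintro (⟨⟩ | x | y) t ht
      · rcases stepRel_add.1 ht with ht | ht
        · obtain ⟨x', hx', rfl⟩ := hs₁ _ _ ht
          exact ⟨.inr (.inl x'), hx', rfl⟩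
        · obtain ⟨y', hy', rfl⟩ := hs₂ _ _ ht
          exact ⟨.inr (.inr y'), hy', rfl⟩
      · obtain ⟨x', hx', rfl⟩ := hs₁ _ _ ht
        exact ⟨.inr (.inl x'), hx', rfl⟩
      · obtain ⟨y', hy', rfl⟩ := hs₂ _ _ ht
        exact ⟨.inr (.inr y'), hy', rfl⟩
    · rintro (⟨⟩ | x | y) ht
      exacts [trivial, hh₁ _ ht, hh₂ _ ht]
  | mul r s ihr ihs =>
    obtain ⟨X, _, R₁, H₁, h₁, x₁, hR₁, hs₁, hh₁, rfl⟩ := ihr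
    obtain ⟨Y, _, R₂, H₂, h₂, x₂, hR₂, hs₂, hh₂, rfl⟩ := ihs
    refine ⟨X ⊕ Y, inferInstance, stack R₁ (fun a b => H₁ a ∧ b = x₂) R₂,
      Sum.elim (fun _ => False) H₂, Sum.elim (fun x => (h₁ x).mul (h₂ x₂)) h₂, .inl x₁,
      .stack hR₁ hR₂ (fun _ _ h => h.1) (fun _ h => h.elim) (fun _ h => h), ?_, ?_, rfl⟩
    · rintro (x | y) t ht
      · rcases stepRel_mul ht with ⟨hH, rfl⟩ | ⟨t', ht', rfl⟩
        · exact ⟨.inr x₂, ⟨hh₁ _ hH, rfl⟩, rfl⟩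
        · obtain ⟨x', hx', rfl⟩ := hs₁ _ _ ht'
          exact ⟨.inl x', hx', rfl⟩
      · obtain ⟨y', hy', rfl⟩ := hs₂ _ _ ht
        exact ⟨.inr y', hy', rfl⟩
    · rintro (x | y) ht
      exacts [not_halts_mul ht, hh₂ _ ht]
  | star r s ihr ihs =>
    obtain ⟨X, _, R₁, H₁, h₁, x₁, hR₁, hs₁, hh₁, rfl⟩ := ihr
    obtain ⟨Y, _, R₂, H₂, h₂, x₂, hR₂, hs₂, hh₂, rfl⟩ := ihs
    refine ⟨X ⊕ (Unit ⊕ Y), inferInstance, iterGraph R₁ H₁ (R₁ x₁) (R₂ x₂) R₂,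
      Sum.elim (fun _ => False) (Sum.elim (fun _ => H₂ x₂) H₂),
      Sum.elim (fun x => (h₁ x).mul ((h₁ x₁).star (h₂ x₂)))
        (Sum.elim (fun _ => (h₁ x₁).star (h₂ x₂)) h₂), .inr (.inl ()),
      .iterGraph hR₁ hR₂ (fun _ h => h) (fun _ h => h), ?_, ?_, rfl⟩
    · rintro (x | ⟨⟩ | y) t ht
      · rcases stepRel_mul ht with ⟨hH, rfl⟩ | ⟨t', ht', rfl⟩
        · exact ⟨.inr (.inl ()), .inl ⟨hh₁ _ hH, rfl⟩, rfl⟩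
        · obtain ⟨x', hx', rfl⟩ := hs₁ _ _ ht'
          exact ⟨.inl x', .inl hx', rfl⟩
      · rcases stepRel_star ht with ht | ht
        · rcases stepRel_mul ht with ⟨-, rfl⟩ | ⟨t', ht', rfl⟩
          · exact ⟨.inr (.inl ()), .inr ⟨rfl, .inl rfl⟩, rfl⟩
          · obtain ⟨x', hx', rfl⟩ := hs₁ _ _ ht'
            exact ⟨.inl x', .inr ⟨rfl, .inr ⟨x', hx', rfl⟩⟩, rfl⟩
        · obtain ⟨y', hy', rfl⟩ := hs₂ _ _ ht
          exact ⟨.inr (.inr y'), .inl hy', rfl⟩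
      · obtain ⟨y', hy', rfl⟩ := hs₂ _ _ ht
        exact ⟨.inr (.inr y'), .inl hy', rfl⟩
    · rintro (x | ⟨⟩ | y) ht
      exacts [not_halts_mul ht, hh₂ _ (halts_star ht), hh₂ _ ht]

/-- Bisimilarity on the states of a chart. -/
def bisimSetoid {X : Type} (C : Chart Act X) : Setoid X where
  r := Bisimilar C C
  iseqv := by
    refine ⟨fun x => ⟨Eq, ?_, rfl⟩, ?_, ?_⟩
    · rintro x _ rfl a
      exact ⟨Iff.rfl, fun x' h => ⟨x', h, rfl⟩, fun x' h => ⟨x', h, rfl⟩⟩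
    · rintro x y ⟨R, hR, hxy⟩
      refine ⟨flip R, fun u v huv a => ?_, hxy⟩
      obtain ⟨h1, h2, h3⟩ := hR v u huv a
      exact ⟨h1.symm, h3, h2⟩
    · rintro x y z ⟨R, hR, hxy⟩ ⟨S, hS, hyz⟩
      refine ⟨Relation.Comp R S, ?_, y, hxy, hyz⟩
      rintro u w ⟨v, huv, hvw⟩ a
      obtain ⟨h1, h2, h3⟩ := hR u v huv a
      obtain ⟨k1, k2, k3⟩ := hS v w hvw a
      refine ⟨h1.trans k1, fun u' hu' => ?_, fun w' hw' => ?_⟩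
      · obtain ⟨v', hv', hr⟩ := h2 u' hu'
        obtain ⟨w', hw', hs⟩ := k2 v' hv'
        exact ⟨w', hw', v', hr, hs⟩
      · obtain ⟨v', hv', hs⟩ := k3 w' hw'
        obtain ⟨u', hu', hr⟩ := h3 v' hv'
        exact ⟨u', hu', v', hr, hs⟩

/-- The chosen representative of a bisimilarity class of expressions. -/
noncomputable def bisimRep (r : StExp Act) : StExp Act :=
  (Quotient.mk (bisimSetoid (synChart Act)) r).out

theorem bisimRep_eq {r s : StExp Act} (h : Bisimilar (synChart Act) (synChart Act) r s) :
    bisimRep r = bisimRep s :=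
  congrArg Quotient.out (Quotient.sound (s := bisimSetoid (synChart Act)) h)

theorem bisimilar_bisimRep (r : StExp Act) :
    Bisimilar (synChart Act) (synChart Act) (bisimRep r) r :=
  Quotient.exact (s := bisimSetoid (synChart Act)) (Quotient.out_eq _)

variable (Act) in
/-- The bisimulation collapse of the syntactic chart, on chosen representatives. -/
noncomputable def collapse : Chart Act (StExp Act) :=
  ⟨fun r => r.tr.image (Prod.map id (Option.map bisimRep))⟩

theorem collapse_tr_bisimRep (r : StExp Act) :
    (collapse Act).tr (bisimRep r) = r.tr.image (Prod.map id (Option.map bisimRep)) := by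
  obtain ⟨R, hR, hr⟩ := bisimilar_bisimRep r
  ext ⟨a, ξ⟩
  obtain ⟨h1, h2, h3⟩ := hR _ _ hr a
  simp only [collapse, Finset.mem_image, Prod.exists, Prod.map_apply, id, Prod.mk.injEq]
  constructor
  · rintro ⟨_, _ | t, ht, rfl, rfl⟩
    · exact ⟨_, none, h1.1 ht, rfl, rfl⟩
    · obtain ⟨t', ht', hb⟩ := h2 t ht
      exact ⟨_, some t', ht', rfl, congrArg some (bisimRep_eq ⟨R, hR, hb⟩).symm⟩
  · rintro ⟨_, _ | t, ht, rfl, rfl⟩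
    · exact ⟨_, none, h1.2 ht, rfl, rfl⟩
    · obtain ⟨t', ht', hb⟩ := h3 t ht
      exact ⟨_, some t', ht', rfl, congrArg some (bisimRep_eq ⟨R, hR, hb⟩)⟩

theorem stepRel_collapse {r t : StExp Act} (h : (collapse Act).StepRel (bisimRep r) t) :
    ∃ t', (synChart Act).StepRel r t' ∧ bisimRep t' = t := by
  obtain ⟨a, h⟩ := h
  rw [collapse_tr_bisimRep] at h
  simp only [Finset.mem_image, Prod.exists, Prod.map_apply, id, Prod.mk.injEq] at h
  obtain ⟨b, _ | t', ht', -, h⟩ := h <;> cases h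
  exact ⟨t', ⟨b, ht'⟩, rfl⟩

theorem halts_collapse {r : StExp Act} (h : (collapse Act).Halts (bisimRep r)) :
    (synChart Act).Halts r := by
  obtain ⟨a, h⟩ := h
  rw [collapse_tr_bisimRep] at h
  simp only [Finset.mem_image, Prod.exists, Prod.map_apply, id, Prod.mk.injEq] at h
  obtain ⟨b, _ | t', ht', -, h⟩ := h <;> cases h
  exact ⟨b, ht'⟩

theorem IsChartSol.comp_bisimRep {S : Finset (StExp Act)} {s : StExp Act → SLAlg Act}
    (hs : IsChartSol (collapse Act) (S.image bisimRep) s) :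
    IsChartSol (synChart Act) S (s ∘ bisimRep) := by
  intro r hr
  rw [Function.comp, hs _ (Finset.mem_image_of_mem _ hr), collapse_tr_bisimRep, Finset.sup_image]
  refine Finset.sup_congr rfl ?_
  rintro ⟨a, _ | t⟩ _ <;> rfl

end Syntactic

/-- Completeness of `SL*` (Grabmayer–Fokkink): 1-free star expressions that are bisimilar
as states of the syntactic chart are provably equivalent. -/
theorem completeness_SLstar {Act : Type} [DecidableEq Act] (r1 r2 : StExp Act)
    (h : Bisimilar (synChart Act) (synChart Act) r1 r2) : SLEq r1 r2 := by
  obtain ⟨X, _, R₁, H₁, h₁, x₁, hR₁, hs₁, hh₁, rfl⟩ := covered r1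
  obtain ⟨Y, _, R₂, H₂, h₂, x₂, hR₂, hs₂, hh₂, rfl⟩ := covered r2
  have hR : LoopElim (Sum.elim H₁ H₂) (stack R₁ (fun _ _ => False) R₂) :=
    .stack hR₁ hR₂ (fun _ _ h => h.elim) (fun _ h => h) fun _ h => h
  set g : X ⊕ Y → StExp Act := Sum.elim h₁ h₂
  have hstep : ∀ x t, (synChart Act).StepRel (g x) t →
      ∃ x', stack R₁ (fun _ _ => False) R₂ x x' ∧ g x' = t := by
    rintro (x | y) t ht
    · obtain ⟨x', hx', rfl⟩ := hs₁ _ _ ht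
      exact ⟨.inl x', hx', rfl⟩
    · obtain ⟨y', hy', rfl⟩ := hs₂ _ _ ht
      exact ⟨.inr y', hy', rfl⟩
  have hhalt : ∀ x, (synChart Act).Halts (g x) → Sum.elim H₁ H₂ x := by
    rintro (x | y) ht
    exacts [hh₁ _ ht, hh₂ _ ht]
  set S : Finset (StExp Act) := Finset.univ.image g with hS
  have hmem : ∀ x, g x ∈ S := fun x => Finset.mem_image_of_mem _ (Finset.mem_univ x)
  have hrange : ∀ t ∈ S, ∃ x, g x = t := by simp [hS]
  have hstep' : ∀ x t, (collapse Act).StepRel (bisimRep (g x)) t →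
      ∃ x', stack R₁ (fun _ _ => False) R₂ x x' ∧ bisimRep (g x') = t := by
    intro x t ht
    obtain ⟨t', ht', rfl⟩ := stepRel_collapse ht
    obtain ⟨x', hx', rfl⟩ := hstep x t' ht'
    exact ⟨x', hx', rfl⟩
  have hrange' : ∀ t ∈ S.image bisimRep, ∃ x, bisimRep (g x) = t := by
    simp only [hS, Finset.image_image, Finset.mem_image, Finset.mem_univ, true_and,
      Function.comp, imp_self, implies_true]
  obtain ⟨⟨s, hs⟩, -⟩ := LoopElim.uniqueChartSol (C := collapse Act) (S := S.image bisimRep)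
    (fun t ht t' htt' => by
      obtain ⟨x, rfl⟩ := hrange' t ht
      obtain ⟨x', -, rfl⟩ := hstep' x t' htt'
      exact Finset.mem_image_of_mem _ (hmem x'))
    (hR.map (fun x => bisimRep (g x)) (fun x t h => hstep' x t h.2.2)
      (fun x h => hhalt x (halts_collapse h)) fun t _ h => hrange' t h.1)
  obtain ⟨-, huniq⟩ := LoopElim.uniqueChartSol (C := synChart Act) (S := S)
    (fun t ht t' htt' => by
      obtain ⟨x, rfl⟩ := hrange t ht
      obtain ⟨x', -, rfl⟩ := hstep x t' htt'
      exact hmem x')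
    (hR.map g (fun x t h => hstep x t h.2.2) hhalt fun t _ h => hrange t h.1)
  have heq := huniq SLAlg.mk (s ∘ bisimRep) (fun r _ => mk_eq_sup_tr r) hs.comp_bisimRep
  refine SLAlg.mk_eq.1 ?_
  exact (heq _ (hmem (.inl x₁))).trans
    ((congrArg s (bisimRep_eq h)).trans (heq _ (hmem (.inr x₂))).symm)
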